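/- There is no rank-4 abstract polytope whose facets and vertex figures are, respectively, all isomorphic to: the tetrahedron {3,3} and the hemioctahedron {3,4}₃; the tetrahedron {3,3} and the hemi-icosahedron {3,5}₅; the octahedron {3,4} and the hemicube {4,3}₃; the hemioctahedron {3,4}₃ and the hemicube {4,3}₃; or the hemioctahedron {3,4}₃ and the cube {4,3}. (That is, there are no locally projective polytopes of types {3,3,4}, {3,3,5} or {3,4,3}.) -/

import Mathlib

universe u v

/-- An abstract polytope of rank `n`: a bounded poset equipped with a rank function
taking values in `{-1, 0, ..., n}`, such that every maximal chain (flag) contains exactly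
one face of each rank, satisfying the diamond condition and strong flag-connectivity. -/
structure APolytope (n : ℕ) : Type (u + 1) where
  /-- the type of faces -/
  α : Type u
  [po : PartialOrder α]
  [bo : BoundedOrder α]
  /-- the rank function -/
  rank : α → ℤ
  rank_bot : rank ⊥ = -1
  rank_top : rank ⊤ = (n : ℤ)
  rank_strictMono : StrictMono rank
  rank_mem : ∀ F : α, rank F ∈ Set.Icc (-1 : ℤ) (n : ℤ)
  /-- every flag (maximal chain) contains exactly one face of each rank `-1, ..., n`
  (hence exactly `n + 2` faces) -/
  flag_ranks : ∀ c : Set α, IsMaxChain (· ≤ ·) c →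
    ∀ i ∈ Set.Icc (-1 : ℤ) (n : ℤ), ∃! F, F ∈ c ∧ rank F = i
  /-- the diamond condition -/
  diamond : ∀ F G : α, F < G → rank G = rank F + 2 →
    ∃ H₁ H₂ : α, H₁ ≠ H₂ ∧ ∀ H : α, (F < H ∧ H < G) ↔ (H = H₁ ∨ H = H₂)
  /-- strong flag-connectivity: any two flags `c`, `d` are joined by a sequence of
  flags, successive ones differing in exactly one face, all containing `c ∩ d` -/
  connected : ∀ c d : Set α, IsMaxChain (· ≤ ·) c → IsMaxChain (· ≤ ·) d →
    Relation.ReflTransGen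
      (fun x y : Set α => IsMaxChain (· ≤ ·) y ∧ c ∩ d ⊆ y ∧
        (∃ F G : α, x \ y = {F} ∧ y \ x = {G})) c d

attribute [instance] APolytope.po APolytope.bo

namespace APolytope

variable {n : ℕ}

/-- A flag of a polytope is a maximal chain. -/
def IsFlag (P : APolytope.{u} n) (c : Set P.α) : Prop := IsMaxChain (· ≤ ·) c

/-- Two polytopes are isomorphic when there is an order isomorphism between their
face posets. -/
def Iso (P : APolytope.{u} n) (Q : APolytope.{v} n) : Prop := Nonempty (P.α ≃o Q.α)

/-- All facets (sections below a rank `n-1` face, including the least face) of `P`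
are isomorphic to the poset `β`. In rank 4, facets are the sections `F/F₋₁` with
`rank F = 3`. -/
def FacetsAre (P : APolytope.{u} 4) (β : Type*) [PartialOrder β] : Prop :=
  ∀ F : P.α, P.rank F = 3 → Nonempty (↥(Set.Iic F) ≃o β)

/-- All vertex figures (sections above a rank `0` face, up to the greatest face) of `P`
are isomorphic to the poset `β`. -/
def VertexFiguresAre (P : APolytope.{u} 4) (β : Type*) [PartialOrder β] : Prop :=
  ∀ x : P.α, P.rank x = 0 → Nonempty (↥(Set.Ici x) ≃o β)

end APolytope

def TetraPosetData : Finset (Finset (Fin 16)) :=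
  {{0},
   {0, 1},
   {0, 2},
   {0, 3},
   {0, 4},
   {0, 1, 2, 5},
   {0, 1, 3, 6},
   {0, 1, 4, 7},
   {0, 2, 3, 8},
   {0, 2, 4, 9},
   {0, 3, 4, 10},
   {0, 1, 2, 3, 5, 6, 8, 11},
   {0, 1, 2, 4, 5, 7, 9, 12},
   {0, 1, 3, 4, 6, 7, 10, 13},
   {0, 2, 3, 4, 8, 9, 10, 14},
   {0, 1, 2, 3, 4, 5, 6, 7, 8, 9, 10, 11, 12, 13, 14, 15}}

abbrev TetraPoset := {S : Finset (Fin 16) // S ∈ TetraPosetData}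

def CubePosetData : Finset (Finset (Fin 28)) :=
  {{0},
   {0, 1},
   {0, 2},
   {0, 1, 2, 3},
   {0, 4},
   {0, 5},
   {0, 4, 5, 6},
   {0, 1, 4, 7},
   {0, 2, 5, 8},
   {0, 1, 2, 3, 4, 5, 6, 7, 8, 9},
   {0, 10},
   {0, 11},
   {0, 10, 11, 12},
   {0, 13},
   {0, 14},
   {0, 13, 14, 15},
   {0, 10, 13, 16},
   {0, 11, 14, 17},
   {0, 10, 11, 12, 13, 14, 15, 16, 17, 18},
   {0, 1, 10, 19},
   {0, 2, 11, 20},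
   {0, 1, 2, 3, 10, 11, 12, 19, 20, 21},
   {0, 4, 13, 22},
   {0, 5, 14, 23},
   {0, 4, 5, 6, 13, 14, 15, 22, 23, 24},
   {0, 1, 4, 7, 10, 13, 16, 19, 22, 25},
   {0, 2, 5, 8, 11, 14, 17, 20, 23, 26},
   {0, 1, 2, 3, 4, 5, 6, 7, 8, 9, 10, 11, 12, 13, 14, 15, 16, 17, 18, 19, 20, 21, 22, 23, 24, 25, 26, 27}}

abbrev CubePoset := {S : Finset (Fin 28) // S ∈ CubePosetData}

def HemicubePosetData : Finset (Finset (Fin 15)) :=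
  {{0},
   {0, 1},
   {0, 2},
   {0, 1, 2, 3},
   {0, 4},
   {0, 5},
   {0, 4, 5, 6},
   {0, 1, 4, 7},
   {0, 2, 5, 8},
   {0, 1, 2, 3, 4, 5, 6, 7, 8, 9},
   {0, 1, 5, 10},
   {0, 2, 4, 11},
   {0, 1, 2, 3, 4, 5, 6, 10, 11, 12},
   {0, 1, 2, 4, 5, 7, 8, 10, 11, 13},
   {0, 1, 2, 3, 4, 5, 6, 7, 8, 9, 10, 11, 12, 13, 14}}

abbrev HemicubePoset := {S : Finset (Fin 15) // S ∈ HemicubePosetData}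

def HemiIcosaPosetData : Finset (Finset (Fin 33)) :=
  {{0},
   {0, 1},
   {0, 2},
   {0, 3},
   {0, 4},
   {0, 5},
   {0, 6},
   {0, 1, 2, 7},
   {0, 1, 3, 8},
   {0, 1, 5, 9},
   {0, 1, 4, 10},
   {0, 1, 6, 11},
   {0, 2, 3, 12},
   {0, 2, 6, 13},
   {0, 2, 4, 14},
   {0, 2, 5, 15},
   {0, 3, 4, 16},
   {0, 3, 5, 17},
   {0, 3, 6, 18},
   {0, 4, 5, 19},
   {0, 4, 6, 20},
   {0, 5, 6, 21},
   {0, 1, 2, 3, 7, 8, 12, 22},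
   {0, 1, 2, 4, 7, 10, 14, 23},
   {0, 1, 3, 6, 8, 11, 18, 24},
   {0, 1, 4, 5, 9, 10, 19, 25},
   {0, 1, 5, 6, 9, 11, 21, 26},
   {0, 2, 3, 5, 12, 15, 17, 27},
   {0, 2, 4, 6, 13, 14, 20, 28},
   {0, 2, 5, 6, 13, 15, 21, 29},
   {0, 3, 4, 5, 16, 17, 19, 30},
   {0, 3, 4, 6, 16, 18, 20, 31},
   {0, 1, 2, 3, 4, 5, 6, 7, 8, 9, 10, 11, 12, 13, 14, 15, 16, 17, 18, 19, 20, 21, 22, 23, 24, 25, 26, 27, 28, 29, 30, 31, 32}}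

abbrev HemiIcosaPoset := {S : Finset (Fin 33) // S ∈ HemiIcosaPosetData}

/-- The octahedron is the order dual of the cube. -/
abbrev OctaPoset := CubePosetᵒᵈ

/-- The hemioctahedron is the order dual of the hemicube. -/
abbrev HemiOctaPoset := HemicubePosetᵒᵈ

section FlagWalks

variable {X Y : Type*}

/-- The three faces `x 0, x 1, x 2` form a chain that can be extended at both ends. In a
polytope of rank 3, these are the proper parts of the flags. -/
def IsFlagTriple (lt : X → X → Prop) (x : Fin 3 → X) : Prop :=
  lt (x 0) (x 1) ∧ lt (x 1) (x 2) ∧ (∃ b, lt b (x 0)) ∧ ∃ t, lt (x 2) t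

/-- The chain `y` differs from `x` exactly in position `i`. -/
def AdjTriple (lt : X → X → Prop) (i : Fin 3) (x y : Fin 3 → X) : Prop :=
  IsFlagTriple lt y ∧ x i ≠ y i ∧ ∀ j, j ≠ i → x j = y j

/-- `y` is reached from `x` by changing faces in the positions listed in `w`, read from right
to left. -/
def Walk (lt : X → X → Prop) : List (Fin 3) → (Fin 3 → X) → (Fin 3 → X) → Prop
  | [], x, y => x = y
  | i :: w, x, y => ∃ z, Walk lt w x z ∧ AdjTriple lt i z y

/-- Every walk with positions `w` returns to its starting point. -/
def ClosedWord (lt : X → X → Prop) (w : List (Fin 3)) : Prop :=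
  ∀ x y, IsFlagTriple lt x → Walk lt w x y → y = x

theorem IsFlagTriple.map {lt : X → X → Prop} {lt' : Y → Y → Prop} {f : X → Y}
    (hf : ∀ a b, lt a b → lt' (f a) (f b)) {x : Fin 3 → X} (h : IsFlagTriple lt x) :
    IsFlagTriple lt' (f ∘ x) := by
  obtain ⟨h1, h2, ⟨b, hb⟩, t, ht⟩ := h
  exact ⟨hf _ _ h1, hf _ _ h2, ⟨_, hf _ _ hb⟩, _, hf _ _ ht⟩

theorem Walk.map {lt : X → X → Prop} {lt' : Y → Y → Prop} {f : X → Y}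
    (hf : ∀ a b, lt a b → lt' (f a) (f b)) (hinj : f.Injective) {w : List (Fin 3)} :
    ∀ {x y : Fin 3 → X}, Walk lt w x y → Walk lt' w (f ∘ x) (f ∘ y) := by
  induction w with
  | nil => rintro x y rfl; rfl
  | cons i w ih =>
    rintro x y ⟨z, hz, h1, h2, h3⟩
    exact ⟨f ∘ z, ih hz, h1.map hf, fun h => h2 (hinj h), fun j hj => congrArg f (h3 j hj)⟩

theorem ClosedWord.of_map {lt : X → X → Prop} {lt' : Y → Y → Prop} {f : X → Y}
    (hf : ∀ a b, lt a b → lt' (f a) (f b)) (hinj : f.Injective) {w : List (Fin 3)}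
    (h : ClosedWord lt' w) : ClosedWord lt w := fun x y hx hw => by
  have := h _ _ (hx.map hf) (hw.map hf hinj)
  exact funext fun j => hinj (congrFun this j)

/-- The relation on a list of natural numbers given by a Boolean relation. -/
def ListRel (D : List ℕ) (L : ℕ → ℕ → Bool) (a b : ℕ) : Prop := a ∈ D ∧ b ∈ D ∧ L a b = true

/-- The list of flag triples of `ListRel D L`. -/
def flagTriples (D : List ℕ) (L : ℕ → ℕ → Bool) : List (Fin 3 → ℕ) :=
  (D.filter fun c => D.any (L c)).flatMap fun c =>
    (D.filter fun b => L b c).flatMap fun b =>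
      (D.filter fun a => L a b && D.any fun z => L z a).map fun a => ![a, b, c]

/-- The endpoints in `fl` of the walks along `w` starting at `x`. -/
def walkEnds (fl : List (Fin 3 → ℕ)) : List (Fin 3) → (Fin 3 → ℕ) → List (Fin 3 → ℕ)
  | [], x => [x]
  | i :: w, x => (walkEnds fl w x).flatMap fun z =>
      fl.filter fun y => decide (z i ≠ y i ∧ ∀ j, j ≠ i → z j = y j)

/-- Boolean test for `ClosedWord (ListRel D L) w`. -/
def closedTest (D : List ℕ) (L : ℕ → ℕ → Bool) (w : List (Fin 3)) : Bool :=
  (flagTriples D L).all fun x => (walkEnds (flagTriples D L) w x).all fun y => decide (y = x)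

theorem IsFlagTriple.mem_flagTriples {D : List ℕ} {L : ℕ → ℕ → Bool} {x : Fin 3 → ℕ}
    (h : IsFlagTriple (ListRel D L) x) : x ∈ flagTriples D L := by
  obtain ⟨⟨h0, h1, h01⟩, ⟨-, h2, h12⟩, ⟨b, hb, -, hb0⟩, t, -, ht, h2t⟩ := h
  simp only [flagTriples, List.mem_flatMap, List.mem_filter, List.mem_map, List.any_eq_true,
    Bool.and_eq_true]
  refine ⟨x 2, ⟨h2, t, ht, h2t⟩, x 1, ⟨h1, h12⟩, x 0, ⟨h0, h01, b, hb, hb0⟩, ?_⟩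
  ext j
  fin_cases j <;> rfl

theorem Walk.mem_walkEnds {D : List ℕ} {L : ℕ → ℕ → Bool} {w : List (Fin 3)} :
    ∀ {x y : Fin 3 → ℕ}, Walk (ListRel D L) w x y → y ∈ walkEnds (flagTriples D L) w x := by
  induction w with
  | nil => rintro x y rfl; simp [walkEnds]
  | cons i w ih =>
    rintro x y ⟨z, hz, h1, h2⟩
    simp only [walkEnds, List.mem_flatMap, List.mem_filter, decide_eq_true_eq]
    exact ⟨z, ih hz, h1.mem_flagTriples, h2⟩

theorem closedWord_of_closedTest {D : List ℕ} {L : ℕ → ℕ → Bool} {w : List (Fin 3)}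
    (h : closedTest D L w = true) : ClosedWord (ListRel D L) w := fun x y hx hw => by
  simp only [closedTest, List.all_eq_true, decide_eq_true_eq] at h
  exact h x hx.mem_flagTriples y hw.mem_walkEnds

end FlagWalks

section Coding

/-- A finite set of small numbers as a bit mask. -/
def bitMask {n : ℕ} (s : Finset (Fin n)) : ℕ := Nat.ofBits fun i => decide (i ∈ s)

/-- Strict inclusion of bit masks. -/
def maskLT (a b : ℕ) : Bool := !(a == b) && (a &&& b) == a

theorem testBit_bitMask {n : ℕ} (s : Finset (Fin n)) (i : Fin n) :
    (bitMask s).testBit i = decide (i ∈ s) := by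
  rw [bitMask, Nat.testBit_ofBits_lt _ _ i.2]

theorem bitMask_injective {n : ℕ} : Function.Injective (bitMask (n := n)) := fun s t h => by
  ext i
  simpa [testBit_bitMask] using congrArg (fun m => m.testBit i) h

theorem maskLT_bitMask {n : ℕ} {s t : Finset (Fin n)} (h : s ⊂ t) :
    maskLT (bitMask s) (bitMask t) = true := by
  simp only [maskLT, Bool.and_eq_true, Bool.not_eq_true', beq_eq_false_iff_ne, beq_iff_eq]
  refine ⟨fun e => h.ne (bitMask_injective e), Nat.eq_of_testBit_eq fun i => ?_⟩
  rw [Nat.testBit_land]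
  by_cases hi : i < n
  · have hs := testBit_bitMask s ⟨i, hi⟩
    have ht := testBit_bitMask t ⟨i, hi⟩
    simp only at hs ht
    rw [hs, ht]
    simpa using fun hi => h.1 hi
  · simp [bitMask, Nat.testBit_ofBits_ge _ _ (not_lt.1 hi)]

/-- The list `D` contains the bit masks of all members of `S`. -/
def Codes {n : ℕ} (S : Finset (Finset (Fin n))) (D : List ℕ) : Prop :=
  ∀ s ∈ S, bitMask s ∈ D

variable {n : ℕ} {S : Finset (Finset (Fin n))} {D : List ℕ} {w : List (Fin 3)}

theorem Codes.closedWord (h : Codes S D) (hw : closedTest D maskLT w = true) :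
    ClosedWord (fun a b : {s // s ∈ S} => a < b) w :=
  ClosedWord.of_map (lt' := ListRel D maskLT) (f := fun a : {s // s ∈ S} => bitMask a.1)
    (fun a b hab => ⟨h a.1 a.2, h b.1 b.2, maskLT_bitMask hab⟩)
    (bitMask_injective.comp Subtype.val_injective) (closedWord_of_closedTest hw)

theorem Codes.closedWord_dual (h : Codes S D)
    (hw : closedTest D (fun a b => maskLT b a) w = true) :
    ClosedWord (fun a b : {s // s ∈ S}ᵒᵈ => a < b) w :=
  ClosedWord.of_map (lt' := ListRel D fun a b => maskLT b a)
    (f := fun a : {s // s ∈ S}ᵒᵈ => bitMask (OrderDual.ofDual a).1)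
    (fun a b hab => ⟨h _ (OrderDual.ofDual a).2, h _ (OrderDual.ofDual b).2,
      maskLT_bitMask (OrderDual.ofDual_lt_ofDual.2 hab)⟩)
    (bitMask_injective.comp (Subtype.val_injective.comp OrderDual.ofDual.injective))
    (closedWord_of_closedTest hw)

/-- Bit masks of `TetraPosetData`. -/
def tetraMasks : List ℕ :=
  [1, 3, 5, 9, 17, 39, 75, 147, 269, 533, 1049, 2415, 4791, 9435, 18205, 65535]

/-- Bit masks of `CubePosetData`. -/
def cubeMasks : List ℕ :=
  [1, 3, 5, 15, 17, 33, 113, 147, 293, 1023, 1025, 2049, 7169, 8193, 16385, 57345, 74753, 149505,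
   523265, 525315, 1050629, 3677199, 4202513, 8405025, 29417585, 38347923, 76695845, 268435455]

/-- Bit masks of `HemicubePosetData`. -/
def hemicubeMasks : List ℕ :=
  [1, 3, 5, 15, 17, 33, 113, 147, 293, 1023, 1059, 2069, 7295, 11703, 32767]

/-- Bit masks of `HemiIcosaPosetData`. -/
def hemiIcosaMasks : List ℕ :=
  [1, 3, 5, 9, 17, 33, 65, 135, 267, 547, 1043, 2115, 4109, 8261, 16405, 32805, 65561, 131113,
   262217, 524337, 1048657, 2097249, 4198799, 8406167, 17041739, 34080307, 69208675, 134385709,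
   269508693, 539009125, 1074462777, 2148859993, 8589934591]

theorem codes_tetra : Codes TetraPosetData tetraMasks := by
  simp only [Codes, TetraPosetData, Finset.forall_mem_insert, Finset.mem_singleton, forall_eq]
  and_intros <;> decide +kernel

theorem codes_cube : Codes CubePosetData cubeMasks := by
  simp only [Codes, CubePosetData, Finset.forall_mem_insert, Finset.mem_singleton, forall_eq]
  and_intros <;> decide +kernel

theorem codes_hemicube : Codes HemicubePosetData hemicubeMasks := by
  simp only [Codes, HemicubePosetData, Finset.forall_mem_insert, Finset.mem_singleton, forall_eq]
  and_intros <;> decide +kernel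

theorem codes_hemiIcosa : Codes HemiIcosaPosetData hemiIcosaMasks := by
  simp only [Codes, HemiIcosaPosetData, Finset.forall_mem_insert, Finset.mem_singleton, forall_eq]
  and_intros <;> decide +kernel

end Coding

section GroupRelations

variable {G : Type*} [Group G]

theorem mul_comm_of_involutions {a b : G} (ha : a * a = 1) (hb : b * b = 1)
    (h : a * (b * (a * (b * 1))) = 1) : a * b = b * a := by
  have ha' : a⁻¹ = a := inv_eq_of_mul_eq_one_left ha
  have hb' : b⁻¹ = b := inv_eq_of_mul_eq_one_left hb
  have h' : (a * b) * (a * b) = 1 := by simpa only [mul_assoc, mul_one] using h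
  rw [← inv_eq_of_mul_eq_one_left h', mul_inv_rev, ha', hb']

theorem braid_of_involutions {a b : G} (ha : a * a = 1) (hb : b * b = 1)
    (h : a * (b * (a * (b * (a * (b * 1))))) = 1) : a * b * a = b * a * b := by
  have ha' : a⁻¹ = a := inv_eq_of_mul_eq_one_left ha
  have hb' : b⁻¹ = b := inv_eq_of_mul_eq_one_left hb
  have h' : (a * b * a) * (b * a * b) = 1 := by simpa only [mul_assoc, mul_one] using h
  rw [← inv_eq_of_mul_eq_one_left h', mul_inv_rev, mul_inv_rev, ha', hb', mul_assoc]

/-- In the Coxeter group `[3,3,4]` modulo the central element of `[3,4]`, the last generator is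
trivial. -/
theorem eq_one_of_hemioctahedral {r₀ r₁ r₂ r₃ : G} (h₀ : r₀ * r₀ = 1) (h₁ : r₁ * r₁ = 1)
    (h₂ : r₂ * r₂ = 1) (h₃ : r₃ * r₃ = 1) (h₀₂ : r₀ * r₂ = r₂ * r₀) (h₀₃ : r₀ * r₃ = r₃ * r₀)
    (h₀₁ : r₀ * r₁ * r₀ = r₁ * r₀ * r₁)
    (hz : r₁ * (r₂ * r₃ * r₂) * r₁ * (r₂ * r₃ * r₂) * r₃ = 1) : r₃ = 1 := by
  obtain ⟨s, hs⟩ : ∃ s, s = r₂ * r₃ * r₂ := ⟨_, rfl⟩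
  rw [← hs] at hz
  have hss : s * s = 1 := by
    calc s * s = r₂ * r₃ * (r₂ * r₂) * r₃ * r₂ := by simp only [hs, mul_assoc]
      _ = r₂ * (r₃ * r₃) * r₂ := by rw [h₂, mul_one]; simp only [mul_assoc]
      _ = 1 := by rw [h₃, mul_one, h₂]
  have h₀s : r₀ * s = s * r₀ := by
    calc r₀ * s = (r₀ * r₂) * r₃ * r₂ := by simp only [hs, mul_assoc]
      _ = r₂ * (r₀ * r₃) * r₂ := by simp only [h₀₂, mul_assoc]
      _ = r₂ * r₃ * (r₀ * r₂) := by simp only [h₀₃, mul_assoc]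
      _ = s * r₀ := by simp only [h₀₂, hs, mul_assoc]
  -- the conjugates of `s` by `r₁` and `r₀ * r₁` agree
  have hu : r₁ * s * r₁ = r₃⁻¹ * s⁻¹ := by
    rw [← mul_inv_rev, eq_inv_iff_mul_eq_one, ← hz]; simp only [mul_assoc]
  have hcomm : r₀ * (r₁ * s * r₁) * r₀ = r₁ * s * r₁ := by
    have c : Commute r₀ (r₃⁻¹ * s⁻¹) :=
      (Commute.inv_right h₀₃).mul_right (Commute.inv_right h₀s)
    rw [hu, c.eq, mul_assoc, h₀, mul_one]
  have hmid : r₁ * (r₀ * (r₁ * s * r₁) * r₀) * r₁ = r₀ * (r₁ * s * r₁) * r₀ := by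
    calc r₁ * (r₀ * (r₁ * s * r₁) * r₀) * r₁
        = (r₁ * r₀ * r₁) * s * (r₁ * r₀ * r₁) := by simp only [mul_assoc]
      _ = r₀ * r₁ * (r₀ * s) * r₀ * r₁ * r₀ := by rw [← h₀₁]; simp only [mul_assoc]
      _ = r₀ * r₁ * s * (r₀ * r₀) * r₁ * r₀ := by rw [h₀s]; simp only [mul_assoc]
      _ = r₀ * (r₁ * s * r₁) * r₀ := by rw [h₀, mul_one]; simp only [mul_assoc]
  have hs' : s = r₁ * s * r₁ := by
    calc s = (r₁ * r₁) * s * (r₁ * r₁) := by rw [h₁, one_mul, mul_one]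
      _ = r₁ * (r₁ * s * r₁) * r₁ := by simp only [mul_assoc]
      _ = r₁ * s * r₁ := by rw [← hcomm, hmid]
  rwa [← hs', hss, one_mul] at hz

/-- In the Coxeter group `[3,4,3]` modulo the central element of `[4,3]`, the first two
generators agree. -/
theorem eq_of_hemicubical {r₀ r₁ r₂ r₃ : G} (h₀ : r₀ * r₀ = 1) (h₁ : r₁ * r₁ = 1)
    (h₂ : r₂ * r₂ = 1) (h₃ : r₃ * r₃ = 1) (h₀₂ : r₀ * r₂ = r₂ * r₀) (h₀₃ : r₀ * r₃ = r₃ * r₀)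
    (h₀₁ : r₀ * r₁ * r₀ = r₁ * r₀ * r₁)
    (hz : r₁ * (r₂ * r₁ * r₂) * (r₃ * r₂ * r₁ * r₂ * r₃) = 1) : r₀ = r₁ := by
  have conj : ∀ {g a : G}, g * g = 1 → r₀ * g = g * r₀ → a * a = 1 ∧ r₀ * a * r₀ = a * r₀ * a →
      g * a * g * (g * a * g) = 1 ∧
        r₀ * (g * a * g) * r₀ = g * a * g * r₀ * (g * a * g) := by
    rintro g a hg hrg ⟨ha, hra⟩
    constructor
    · calc g * a * g * (g * a * g) = g * a * (g * g) * a * g := by simp only [mul_assoc]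
        _ = g * (a * a) * g := by rw [hg, mul_one]; simp only [mul_assoc]
        _ = 1 := by rw [ha, mul_one, hg]
    · calc r₀ * (g * a * g) * r₀ = r₀ * g * (a * (g * r₀)) := by simp only [mul_assoc]
        _ = g * r₀ * (a * (r₀ * g)) := by rw [hrg]
        _ = g * (r₀ * a * r₀) * g := by simp only [mul_assoc]
        _ = g * a * (g * g) * r₀ * a * g := by rw [hra, hg, mul_one]; simp only [mul_assoc]
        _ = g * a * g * (g * r₀) * a * g := by simp only [mul_assoc]
        _ = g * a * g * r₀ * (g * a * g) := by rw [← hrg]; simp only [mul_assoc]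
  obtain ⟨h22, hr2⟩ := conj h₂ h₀₂ ⟨h₁, h₀₁⟩
  obtain ⟨h33, hr3⟩ := conj h₃ h₀₃ ⟨h22, hr2⟩
  have e : r₃ * (r₂ * r₁ * r₂) * r₃ = r₃ * r₂ * r₁ * r₂ * r₃ := by simp only [mul_assoc]
  rw [e] at h33 hr3
  generalize r₂ * r₁ * r₂ = u at *
  generalize r₃ * r₂ * r₁ * r₂ * r₃ = v at *
  have huv : u * v = r₁ := by
    calc u * v = r₁ * (r₁ * u * v) := by rw [← mul_assoc, ← mul_assoc, h₁, one_mul]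
      _ = r₁ := by rw [hz, mul_one]
  have h1u : r₁ * u = v := by
    calc r₁ * u = r₁ * u * v * v := by rw [mul_assoc _ v v, h33, mul_one]
      _ = v := by rw [hz, one_mul]
  have huv' : u * r₁ = v := by rw [← huv, ← mul_assoc, h22, one_mul]
  have hv1 : v * r₁ = u := by rw [← huv', mul_assoc, h₁, mul_one]
  have h1v : r₁ * v = u := by rw [← h1u, ← mul_assoc, h₁, one_mul]
  have h0v : v * r₀ = 1 := by
    calc v * r₀ = r₁ * (u * r₀ * u) * u := by
          rw [← h1u, mul_assoc r₁ (u * r₀ * u), mul_assoc _ u u, h22, mul_one, ← mul_assoc]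
      _ = r₁ * r₀ * u * r₀ * u := by rw [← hr2]; simp only [mul_assoc]
      _ = r₁ * r₀ * v * (r₁ * r₀ * r₁) * v := by
        nth_rw 2 [← h1v]; rw [← hv1]; simp only [mul_assoc]
      _ = r₁ * r₀ * (r₁ * u) * r₀ * (u * v) * r₀ * v := by
        rw [← h₀₁, huv, h1u, h₀₁]; nth_rw 1 [← h₀₁]; simp only [mul_assoc]
      _ = (r₁ * r₀ * r₁) * (u * r₀ * u) * (v * r₀ * v) := by simp only [mul_assoc]
      _ = r₀ * r₁ * (r₀ * r₀) * u * (r₀ * r₀) * v * r₀ := by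
        rw [← h₀₁, ← hr2, ← hr3]; simp only [mul_assoc]
      _ = r₀ * (r₁ * u * v) * r₀ := by rw [h₀, mul_one, mul_one]; simp only [mul_assoc]
      _ = 1 := by rw [hz, mul_one, h₀]
  have hr₀ : r₀ = v := by rw [← one_mul r₀, ← h33, mul_assoc, h0v, mul_one]
  rw [hr₀, mul_assoc, h1v, huv', mul_eq_left] at h₀₁
  rw [hr₀, ← h1u, h₀₁, mul_one]

/-- In the Coxeter group `[3,3,5]` modulo the central element of `[3,5]`, the first generator
lies in the subgroup generated by the others. -/
theorem mem_of_hemiIcosahedral (H : Subgroup G) {r t s c : G} (hr : r * r = 1) (ht : t * t = 1)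
    (hrs : r * s = s * r) (hrc : r * c = c * r) (hrt : r * t * r = t * r * t) (hc : c ^ 5 = 1)
    (hx : (t * c ^ 2) ^ 3 = 1) (htc : t * c⁻¹ * t = c⁻¹ * t * s)
    (htH : t ∈ H) (hsH : s ∈ H) (hcH : c ∈ H) : r ∈ H := by
  obtain ⟨x, hxc⟩ : ∃ x, x = c ^ 2 := ⟨_, rfl⟩
  have hxx : x * x = c⁻¹ := by
    rw [hxc, eq_inv_iff_mul_eq_one, ← hc]; group
  have hrx : Commute r x := hxc ▸ Commute.pow_right hrc 2
  have ht' : t⁻¹ = t := inv_eq_of_mul_eq_one_left ht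
  rw [← hxc] at hx
  have hA : t * x * t = x⁻¹ * t * x⁻¹ := by
    calc t * x * t = (t * x) ^ 3 * (x⁻¹ * t⁻¹ * x⁻¹) := by
          simp [pow_succ, mul_assoc]
      _ = x⁻¹ * t * x⁻¹ := by rw [hx, one_mul, ht']
  have hA' : t * x⁻¹ * t = x * t * x := by
    have := congrArg (·⁻¹) hA
    simpa [ht', mul_assoc] using this
  have h1 : x⁻¹ * (t * r * t) * x⁻¹ = x * t * x * r * (x * t * x) := by
    calc x⁻¹ * (t * r * t) * x⁻¹ = x⁻¹ * r * (t * (r * x⁻¹)) := by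
          rw [← hrt]; simp only [mul_assoc]
      _ = r * x⁻¹ * (t * (x⁻¹ * r)) := by rw [hrx.inv_right.eq]
      _ = r * (x⁻¹ * t * x⁻¹) * r := by simp only [mul_assoc]
      _ = r * t * (r * r) * x * t * r := by rw [← hA, hr, mul_one]; simp only [mul_assoc]
      _ = r * t * r * (r * x) * t * r := by simp only [mul_assoc]
      _ = r * t * r * x * (r * t * r) := by rw [hrx.eq]; simp only [mul_assoc]
      _ = t * r * (t * x * t) * r * t := by rw [hrt]; simp only [mul_assoc]
      _ = t * (r * x⁻¹) * (t * (x⁻¹ * r) * t) := by rw [hA]; simp only [mul_assoc]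
      _ = t * (x⁻¹ * r) * (t * (r * x⁻¹) * t) := by rw [hrx.inv_right.eq]
      _ = t * x⁻¹ * (r * t * r) * x⁻¹ * t := by simp only [mul_assoc]
      _ = (t * x⁻¹ * t) * r * (t * x⁻¹ * t) := by rw [hrt]; simp only [mul_assoc]
      _ = _ := by rw [hA']
  have h2 : t * r * t = c⁻¹ * t * r * c⁻¹ * t * c⁻¹ := by
    calc t * r * t = x * (x⁻¹ * (t * r * t) * x⁻¹) * x := by group
      _ = x * x * t * (x * r) * (x * t * (x * x)) := by rw [h1]; simp only [mul_assoc]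
      _ = x * x * t * r * (x * x) * t * (x * x) := by rw [← hrx.eq]; simp only [mul_assoc]
      _ = _ := by rw [hxx]
  have h3 : r = c⁻¹ * t * r * s * c⁻¹ * t * c⁻¹ * t := by
    calc r = (t * t) * r * (t * t) := by rw [ht, one_mul, mul_one]
      _ = t * (t * r * t) * t := by simp only [mul_assoc]
      _ = (t * c⁻¹ * t) * r * c⁻¹ * t * c⁻¹ * t := by rw [h2]; simp only [mul_assoc]
      _ = c⁻¹ * t * (s * r) * c⁻¹ * t * c⁻¹ * t := by rw [htc]; simp only [mul_assoc]
      _ = _ := by rw [← hrs]; simp only [mul_assoc]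
  have h4 : r * t * r = s * c⁻¹ * t * c⁻¹ * t * c⁻¹ := by
    calc r * t * r = r * t * (r * c) * c⁻¹ := by group
      _ = r * t * c * r * c⁻¹ := by rw [hrc]; simp only [mul_assoc]
      _ = r * t * c * (c⁻¹ * t * r * s * c⁻¹ * t * c⁻¹ * t) * c⁻¹ := by rw [← h3]
      _ = r * (t * t) * r * s * c⁻¹ * t * c⁻¹ * t * c⁻¹ := by group
      _ = _ := by rw [ht, mul_one, hr, one_mul]
  have h5 : r = t * (s * c⁻¹ * t * c⁻¹ * t * c⁻¹) * t := by
    calc r = (t * t) * r * (t * t) := by rw [ht, one_mul, mul_one]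
      _ = t * (t * r * t) * t := by simp only [mul_assoc]
      _ = _ := by rw [← hrt, h4]
  have hcH' := H.inv_mem hcH
  rw [h5]
  exact H.mul_mem (H.mul_mem htH (H.mul_mem (H.mul_mem (H.mul_mem (H.mul_mem (H.mul_mem hsH hcH')
    htH) hcH') htH) hcH')) htH

end GroupRelations

namespace APolytope

variable {P : APolytope.{u} 4}

/-- The proper part of a flag of a polytope of rank 4: its faces of rank `0, 1, 2, 3`. -/
@[ext]
structure PFlag (P : APolytope.{u} 4) where
  /-- the face of rank `i` -/
  face : Fin 4 → P.α
  rank_face : ∀ i, P.rank (face i) = (i : ℕ)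
  strictMono : StrictMono face

theorem nonempty_pflag (P : APolytope.{u} 4) : Nonempty (PFlag P) := by
  have hmax : IsMaxChain (· ≤ ·) (maxChain ((· ≤ ·) : P.α → P.α → Prop)) := maxChain_spec
  have h : ∀ i : Fin 4, ∃ F, F ∈ maxChain ((· ≤ ·) : P.α → P.α → Prop) ∧
      P.rank F = (i : ℕ) := fun i =>
    (P.flag_ranks _ hmax (i : ℕ) ⟨by omega, by norm_num⟩).exists
  choose f hf hr using h
  refine ⟨⟨f, hr, fun i j hij => ?_⟩⟩
  have hlt : P.rank (f i) < P.rank (f j) := by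
    rw [hr, hr]; exact_mod_cast hij
  refine lt_of_le_of_ne ?_ fun h => hlt.ne (by rw [h])
  exact (hmax.1.total (hf i) (hf j)).resolve_right fun h =>
    hlt.not_ge (P.rank_strictMono.monotone h)

theorem PFlag.exists_bounds (φ : PFlag P) (i : Fin 4) :
    ∃ F G, F < G ∧ P.rank G = P.rank F + 2 ∧ ∀ H, (F < H ∧ H < G) ↔
      P.rank H = (i : ℕ) ∧ (∀ j < i, φ.face j < H) ∧ ∀ j, i < j → H < φ.face j := by
  have hr := φ.rank_face
  have hm := φ.strictMono
  have hlo : ∀ H : P.α, P.rank H ≠ -1 → ⊥ < H := fun H h =>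
    bot_lt_iff_ne_bot.2 fun e => h (e ▸ P.rank_bot)
  have hhi : ∀ H : P.α, P.rank H ≠ 4 → H < ⊤ := fun H h =>
    lt_top_iff_ne_top.2 fun e => h (e ▸ P.rank_top)
  have hs := P.rank_strictMono
  have hrk : ∀ {F G H : P.α} {k : ℤ}, P.rank F = k - 1 → P.rank G = k + 1 → F < H → H < G →
      P.rank H = k := fun h1 h2 h3 h4 => by
    have := hs h3
    have := hs h4
    omega
  have r0 : P.rank (φ.face 0) = 0 := hr 0
  have r1 : P.rank (φ.face 1) = 1 := hr 1
  have r2 : P.rank (φ.face 2) = 2 := hr 2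
  have r3 : P.rank (φ.face 3) = 3 := hr 3
  have m01 : φ.face 0 < φ.face 1 := hm (by decide)
  have m12 : φ.face 1 < φ.face 2 := hm (by decide)
  have m23 : φ.face 2 < φ.face 3 := hm (by decide)
  have rb := P.rank_bot
  have rt : P.rank ⊤ = 4 := P.rank_top
  have four : ∀ j : Fin 4, j = 0 ∨ j = 1 ∨ j = 2 ∨ j = 3 := by decide
  rcases four i with rfl | rfl | rfl | rfl
  · refine ⟨⊥, φ.face 1, hlo _ (by omega), by omega, fun H => ⟨fun ⟨h1, h2⟩ => ⟨?_, fun j hj => ?_,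
      fun j hj => ?_⟩, fun ⟨h, h1, h2⟩ => ⟨hlo _ (by rw [h]; decide), h2 1 (by decide)⟩⟩⟩
    · change P.rank H = (0 : ℤ)
      exact hrk (by omega) (by omega) h1 h2
    all_goals
      rcases four j with rfl | rfl | rfl | rfl <;> first | exact absurd hj (by decide) | order
  · refine ⟨φ.face 0, φ.face 2, m01.trans m12, by omega, fun H => ⟨fun ⟨h1, h2⟩ => ⟨?_, fun j hj => ?_,
      fun j hj => ?_⟩, fun ⟨h, h1, h2⟩ => ⟨h1 0 (by decide), h2 2 (by decide)⟩⟩⟩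
    · change P.rank H = (1 : ℤ)
      exact hrk (by omega) (by omega) h1 h2
    all_goals
      rcases four j with rfl | rfl | rfl | rfl <;> first | exact absurd hj (by decide) | order
  · refine ⟨φ.face 1, φ.face 3, m12.trans m23, by omega, fun H => ⟨fun ⟨h1, h2⟩ => ⟨?_, fun j hj => ?_,
      fun j hj => ?_⟩, fun ⟨h, h1, h2⟩ => ⟨h1 1 (by decide), h2 3 (by decide)⟩⟩⟩
    · change P.rank H = (2 : ℤ)
      exact hrk (by omega) (by omega) h1 h2
    all_goals
      rcases four j with rfl | rfl | rfl | rfl <;> first | exact absurd hj (by decide) | order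
  · refine ⟨φ.face 2, ⊤, hhi _ (by omega), by omega, fun H => ⟨fun ⟨h1, h2⟩ => ⟨?_, fun j hj => ?_,
      fun j hj => ?_⟩, fun ⟨h, h1, h2⟩ => ⟨h1 2 (by decide), hhi _ (by rw [h]; decide)⟩⟩⟩
    · change P.rank H = (3 : ℤ)
      exact hrk (by omega) (by omega) h1 h2
    all_goals
      rcases four j with rfl | rfl | rfl | rfl <;> first | exact absurd hj (by decide) | order

/-- The flags `φ` and `ψ` differ exactly in their faces of rank `i`. -/
def PFlag.Adj (i : Fin 4) (φ ψ : PFlag P) : Prop :=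
  φ.face i ≠ ψ.face i ∧ ∀ j, j ≠ i → φ.face j = ψ.face j

theorem PFlag.Adj.symm {i : Fin 4} {φ ψ : PFlag P} (h : φ.Adj i ψ) : ψ.Adj i φ :=
  ⟨h.1.symm, fun j hj => (h.2 j hj).symm⟩

theorem PFlag.exists_adj (φ : PFlag P) (i : Fin 4) : ∃! ψ : PFlag P, φ.Adj i ψ := by
  obtain ⟨F, G, hFG, hr, h⟩ := φ.exists_bounds i
  obtain ⟨H₁, H₂, hne, hH⟩ := P.diamond F G hFG hr
  have key : ∃ H, H ≠ φ.face i ∧ (F < H ∧ H < G) ∧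
      ∀ H', F < H' ∧ H' < G → H' ≠ φ.face i → H' = H := by
    have hi : φ.face i = H₁ ∨ φ.face i = H₂ := (hH _).1 <| (h _).2
      ⟨φ.rank_face i, fun j hj => φ.strictMono hj, fun j hj => φ.strictMono hj⟩
    rcases hi with hi | hi
    · exact ⟨H₂, hi ▸ hne.symm, (hH _).2 (.inr rfl),
        fun H' h1 h2 => ((hH _).1 h1).resolve_left (hi ▸ h2)⟩
    · exact ⟨H₁, hi ▸ hne, (hH _).2 (.inl rfl),
        fun H' h1 h2 => ((hH _).1 h1).resolve_right (hi ▸ h2)⟩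
  obtain ⟨H, hHi, hH, huniq⟩ := key
  obtain ⟨hrank, hlo, hhi⟩ := (h H).1 hH
  refine ⟨⟨Function.update φ.face i H, fun j => ?_, fun j k hjk => ?_⟩, ⟨?_, fun j hj => ?_⟩,
    fun ψ hψ => ?_⟩
  · rcases eq_or_ne j i with rfl | hj
    · simpa using hrank
    · simpa [hj] using φ.rank_face j
  · rcases eq_or_ne j i with rfl | hj
    · simpa [hjk.ne'] using hhi k hjk
    · rcases eq_or_ne k i with rfl | hk
      · simpa [hj] using hlo j hjk
      · simpa [hj, hk] using φ.strictMono hjk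
  · simpa using hHi.symm
  · simp [hj]
  · ext j
    rcases eq_or_ne j i with rfl | hj
    · simp only [Function.update_self]
      refine huniq _ ((h _).2 ⟨ψ.rank_face j, fun k hk => ?_, fun k hk => ?_⟩) hψ.1.symm
      · rw [hψ.2 k hk.ne]; exact ψ.strictMono hk
      · rw [hψ.2 k hk.ne']; exact ψ.strictMono hk
    · simp [hj, hψ.2 j hj]

/-- The unique flag differing from `φ` exactly in its face of rank `i`. -/
noncomputable def PFlag.flip (i : Fin 4) (φ : PFlag P) : PFlag P := (φ.exists_adj i).choose

theorem PFlag.adj_flip (i : Fin 4) (φ : PFlag P) : φ.Adj i (φ.flip i) :=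
  (φ.exists_adj i).choose_spec.1

theorem PFlag.Adj.eq_flip {i : Fin 4} {φ ψ : PFlag P} (h : φ.Adj i ψ) : ψ = φ.flip i :=
  (φ.exists_adj i).unique h (φ.adj_flip i)

/-- The permutation of the flags that exchanges `i`-adjacent flags. -/
noncomputable def flipPerm (P : APolytope.{u} 4) (i : Fin 4) : Equiv.Perm (PFlag P) :=
  Function.Involutive.toPerm (PFlag.flip i) fun φ => (φ.adj_flip i).symm.eq_flip.symm

theorem adj_flipPerm (i : Fin 4) (φ : PFlag P) : φ.Adj i (flipPerm P i φ) := φ.adj_flip i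

theorem flipPerm_eq {i : Fin 4} {φ ψ : PFlag P} (h : φ.Adj i ψ) : flipPerm P i φ = ψ :=
  h.eq_flip.symm

theorem flipPerm_mul_self (i : Fin 4) : flipPerm P i * flipPerm P i = 1 :=
  Equiv.ext fun φ => (φ.adj_flip i).symm.eq_flip.symm

theorem flipPerm_ne_one (i : Fin 4) : flipPerm P i ≠ 1 := fun h => by
  obtain ⟨φ⟩ := nonempty_pflag P
  have := (adj_flipPerm i φ).1
  rw [h] at this
  exact this rfl

theorem flipPerm_injective (P : APolytope.{u} 4) : Function.Injective (flipPerm P) :=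
    fun i j h => by
  obtain ⟨φ⟩ := nonempty_pflag P
  by_contra hij
  refine (adj_flipPerm i φ).1 ?_
  rw [h]
  exact (adj_flipPerm j φ).2 i hij

theorem flipPerm_zero_mul_three :
    flipPerm P 0 * flipPerm P 3 = flipPerm P 3 * flipPerm P 0 := by
  ext1 φ
  have h3 := (adj_flipPerm 3 φ).2
  have h0 := adj_flipPerm 0 (flipPerm P 3 φ)
  set ψ := flipPerm P 0 (flipPerm P 3 φ) with hψ
  have e1 : ψ.face 1 = φ.face 1 := by rw [h3 1 (by decide), h0.2 1 (by decide)]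
  have e2 : ψ.face 2 = φ.face 2 := by rw [h3 2 (by decide), h0.2 2 (by decide)]
  let θ : PFlag P :=
    { face := Function.update ψ.face 3 (φ.face 3)
      rank_face := fun i => by
        rcases eq_or_ne i 3 with rfl | hi
        · simpa using φ.rank_face 3
        · simpa [hi] using ψ.rank_face i
      strictMono := by
        rw [Fin.strictMono_iff_lt_succ]
        intro i
        fin_cases i
        · exact ψ.strictMono (by decide : (0 : Fin 4) < 1)
        · exact ψ.strictMono (by decide : (1 : Fin 4) < 2)
        · change ψ.face 2 < φ.face 3
          rw [e2]
          exact φ.strictMono (by decide) }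
  have hφθ : φ.Adj 0 θ := by
    refine ⟨?_, fun j hj => ?_⟩
    · change φ.face 0 ≠ ψ.face 0
      rw [h3 0 (by decide)]
      exact h0.1
    · fin_cases j
      · exact absurd rfl hj
      · exact e1.symm
      · exact e2.symm
      · rfl
  have hθψ : θ.Adj 3 ψ := by
    refine ⟨?_, fun j hj => Function.update_of_ne hj _ _⟩
    change φ.face 3 ≠ ψ.face 3
    rw [← h0.2 3 (by decide)]
    exact (adj_flipPerm 3 φ).1
  rw [Equiv.Perm.mul_apply, Equiv.Perm.mul_apply, flipPerm_eq hφθ, flipPerm_eq hθψ]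

/-- The product of the flag permutations listed in `w`. -/
noncomputable def wordPerm (P : APolytope.{u} 4) (w : List (Fin 4)) : Equiv.Perm (PFlag P) :=
  (w.map (flipPerm P)).prod

/-- A word that is closed in a section of rank 3 acts trivially on the flags through it. -/
theorem wordPerm_apply_of_closedWord {β : Type*} [PartialOrder β] {σ : Fin 3 → Fin 4}
    {k : Fin 4} (hσ : StrictMono σ) (hσk : ∀ j, σ j ≠ k) (hcover : ∀ i, i = k ∨ ∃ j, i = σ j)
    {F : P.α} {S : Set P.α} (e : S ≃o β)
    (hS : ∀ φ : PFlag P, φ.face k = F → (∀ j, φ.face (σ j) ∈ S) ∧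
      (∃ b ∈ S, b < φ.face (σ 0)) ∧ ∃ t ∈ S, φ.face (σ 2) < t)
    {w : List (Fin 3)} (hw : ClosedWord (fun a b : β => a < b) w) (φ : PFlag P)
    (hφ : φ.face k = F) : wordPerm P (w.map σ) φ = φ := by
  let g : ∀ ψ : PFlag P, ψ.face k = F → Fin 3 → β := fun ψ h j => e ⟨ψ.face (σ j), (hS ψ h).1 j⟩
  have hflag : ∀ ψ h, IsFlagTriple (· < ·) (g ψ h) := fun ψ h => by
    obtain ⟨h1, ⟨b, hb, hb0⟩, t, ht, h2t⟩ := hS ψ h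
    exact ⟨e.strictMono (ψ.strictMono (hσ (by decide))),
      e.strictMono (ψ.strictMono (hσ (by decide))),
      ⟨e ⟨b, hb⟩, e.strictMono hb0⟩, e ⟨t, ht⟩, e.strictMono h2t⟩
  have hinj : ∀ {ψ θ : PFlag P} (h h') {j}, g ψ h j = g θ h' j → ψ.face (σ j) = θ.face (σ j) :=
    fun _ _ _ h => congrArg Subtype.val (e.injective h)
  have hwalk : ∀ w : List (Fin 3), ∃ h : (wordPerm P (w.map σ) φ).face k = F,
      Walk (· < ·) w (g φ hφ) (g _ h) := fun w => by
    induction w with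
    | nil => exact ⟨hφ, rfl⟩
    | cons i w ih =>
      obtain ⟨h, hw⟩ := ih
      have hadj := adj_flipPerm (σ i) (wordPerm P (w.map σ) φ)
      have hk : (wordPerm P ((i :: w).map σ) φ).face k = F :=
        (hadj.2 k (hσk i).symm).symm.trans h
      refine ⟨hk, _, hw, hflag _ hk, fun he => hadj.1 (hinj h hk he),
        fun j hj => ?_⟩
      exact congrArg e (Subtype.ext (hadj.2 (σ j) (hσ.injective.ne hj)))
  obtain ⟨h, hwalk⟩ := hwalk w
  have heq := hw _ _ (hflag φ hφ) hwalk
  ext i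
  rcases hcover i with rfl | ⟨j, rfl⟩
  · rw [h, hφ]
  · exact hinj h hφ (congrFun heq j)

theorem FacetsAre.wordPerm_eq_one {β : Type*} [PartialOrder β] (h : P.FacetsAre β)
    {w : List (Fin 3)} (hw : ClosedWord (fun a b : β => a < b) w) :
    wordPerm P (w.map Fin.castSucc) = 1 := by
  ext1 φ
  obtain ⟨e⟩ := h (φ.face 3) (φ.rank_face 3)
  refine wordPerm_apply_of_closedWord (k := 3) Fin.strictMono_castSucc (by decide) (by decide) e
    (fun ψ hψ => ⟨fun j => ?_, ⟨⊥, bot_le, ?_⟩, _, le_refl _, ?_⟩) hw φ rfl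
  · exact hψ ▸ (ψ.strictMono (Fin.castSucc_lt_last j)).le
  · refine bot_lt_iff_ne_bot.2 fun hb => ?_
    have := ψ.rank_face 0
    have hb : ψ.face 0 = ⊥ := hb
    rw [hb, P.rank_bot] at this
    norm_num at this
  · exact hψ ▸ ψ.strictMono (Fin.castSucc_lt_last 2)

theorem VertexFiguresAre.wordPerm_eq_one {β : Type*} [PartialOrder β] (h : P.VertexFiguresAre β)
    {w : List (Fin 3)} (hw : ClosedWord (fun a b : β => a < b) w) :
    wordPerm P (w.map Fin.succ) = 1 := by
  ext1 φ
  obtain ⟨e⟩ := h (φ.face 0) (φ.rank_face 0)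
  refine wordPerm_apply_of_closedWord (k := 0) Fin.strictMono_succ (by decide) (by decide) e
    (fun ψ hψ => ⟨fun j => ?_, ⟨_, le_refl _, ?_⟩, ⊤, le_top, ?_⟩) hw φ rfl
  · exact hψ ▸ (ψ.strictMono (Fin.succ_pos j)).le
  · exact hψ ▸ ψ.strictMono (Fin.succ_pos 0)
  · refine lt_top_iff_ne_top.2 fun ht => ?_
    have := ψ.rank_face 3
    have ht : ψ.face 3 = ⊤ := ht
    rw [ht, P.rank_top] at this
    norm_num at this

theorem flipPerm_comm_of_word {i j : Fin 4} (h : wordPerm P [i, j, i, j] = 1) :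
    flipPerm P i * flipPerm P j = flipPerm P j * flipPerm P i :=
  mul_comm_of_involutions (flipPerm_mul_self i) (flipPerm_mul_self j) h

theorem flipPerm_braid_of_word {i j : Fin 4} (h : wordPerm P [i, j, i, j, i, j] = 1) :
    flipPerm P i * flipPerm P j * flipPerm P i = flipPerm P j * flipPerm P i * flipPerm P j :=
  braid_of_involutions (flipPerm_mul_self i) (flipPerm_mul_self j) h

theorem not_hemioctahedral_vertexFigures (h₀₂ : wordPerm P [0, 2, 0, 2] = 1)
    (h₀₁ : wordPerm P [0, 1, 0, 1, 0, 1] = 1) : ¬ P.VertexFiguresAre HemiOctaPoset := fun h => by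
  refine flipPerm_ne_one 3 (eq_one_of_hemioctahedral (flipPerm_mul_self 0) (flipPerm_mul_self 1)
    (flipPerm_mul_self 2) (flipPerm_mul_self 3) (flipPerm_comm_of_word h₀₂)
    flipPerm_zero_mul_three (flipPerm_braid_of_word h₀₁) ?_)
  simpa [wordPerm, mul_assoc] using h.wordPerm_eq_one
    (codes_hemicube.closedWord_dual (w := [0, 1, 2, 1, 0, 1, 2, 1, 2]) (by decide +kernel))

theorem not_hemicubical_vertexFigures (h₀₂ : wordPerm P [0, 2, 0, 2] = 1)
    (h₀₁ : wordPerm P [0, 1, 0, 1, 0, 1] = 1) : ¬ P.VertexFiguresAre HemicubePoset := fun h => by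
  refine absurd (flipPerm_injective P (eq_of_hemicubical (flipPerm_mul_self 0)
    (flipPerm_mul_self 1) (flipPerm_mul_self 2) (flipPerm_mul_self 3) (flipPerm_comm_of_word h₀₂)
    flipPerm_zero_mul_three (flipPerm_braid_of_word h₀₁) ?_)) (by decide)
  simpa [wordPerm, mul_assoc] using h.wordPerm_eq_one
    (codes_hemicube.closedWord (w := [0, 1, 0, 1, 2, 1, 0, 1, 2]) (by decide +kernel))

theorem not_hemioctahedral_facets (h₁₃ : wordPerm P [3, 1, 3, 1] = 1)
    (h₂₃ : wordPerm P [3, 2, 3, 2, 3, 2] = 1) : ¬ P.FacetsAre HemiOctaPoset := fun h => by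
  refine absurd (flipPerm_injective P (eq_of_hemicubical (flipPerm_mul_self 3)
    (flipPerm_mul_self 2) (flipPerm_mul_self 1) (flipPerm_mul_self 0) (flipPerm_comm_of_word h₁₃)
    flipPerm_zero_mul_three.symm (flipPerm_braid_of_word h₂₃) ?_)) (by decide)
  simpa [wordPerm, mul_assoc] using h.wordPerm_eq_one
    (codes_hemicube.closedWord_dual (w := [2, 1, 2, 1, 0, 1, 2, 1, 0]) (by decide +kernel))

/-- The permutations of the flags that preserve the vertex of every flag. -/
def vertexFixer (P : APolytope.{u} 4) : Subgroup (Equiv.Perm (PFlag P)) where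
  carrier := {g | ∀ φ, (g φ).face 0 = φ.face 0}
  mul_mem' ha hb φ := (ha _).trans (hb φ)
  one_mem' _ := rfl
  inv_mem' {g} hg φ := by rw [← hg (g⁻¹ φ), ← Equiv.Perm.mul_apply, mul_inv_cancel, Equiv.Perm.one_apply]

theorem flipPerm_mem_vertexFixer_iff {i : Fin 4} : flipPerm P i ∈ vertexFixer P ↔ i ≠ 0 := by
  constructor
  · rintro h rfl
    obtain ⟨φ⟩ := nonempty_pflag P
    exact (adj_flipPerm 0 φ).1 (h φ).symm
  · exact fun hi φ => ((adj_flipPerm i φ).2 0 hi.symm).symm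

theorem not_hemiIcosahedral_vertexFigures (h₀₂ : wordPerm P [0, 2, 0, 2] = 1)
    (h₀₁ : wordPerm P [0, 1, 0, 1, 0, 1] = 1) : ¬ P.VertexFiguresAre HemiIcosaPoset := fun h => by
  have hword : ∀ w, closedTest hemiIcosaMasks maskLT w = true →
      wordPerm P (w.map Fin.succ) = 1 := fun w hw =>
    h.wordPerm_eq_one (codes_hemiIcosa.closedWord hw)
  have hinv : ∀ i, (flipPerm P i)⁻¹ = flipPerm P i := fun i =>
    inv_eq_of_mul_eq_one_left (flipPerm_mul_self i)
  have hcomm : Commute (flipPerm P 0) (flipPerm P 2) := flipPerm_comm_of_word h₀₂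
  have hmem : ∀ i, i ≠ 0 → flipPerm P i ∈ vertexFixer P := fun i =>
    flipPerm_mem_vertexFixer_iff.2
  refine flipPerm_mem_vertexFixer_iff.1 (mem_of_hemiIcosahedral (vertexFixer P)
    (c := flipPerm P 2 * flipPerm P 3) (flipPerm_mul_self 0) (flipPerm_mul_self 1) hcomm
    (hcomm.mul_right flipPerm_zero_mul_three) (flipPerm_braid_of_word h₀₁) ?_ ?_ ?_
    (hmem 1 (by decide)) (hmem 2 (by decide))
    (mul_mem (hmem 2 (by decide)) (hmem 3 (by decide)))) rfl
  · simpa [wordPerm, mul_assoc, pow_succ] using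
      hword [1, 2, 1, 2, 1, 2, 1, 2, 1, 2] (by decide +kernel)
  · simpa [wordPerm, mul_assoc, pow_succ] using
      hword [0, 1, 2, 1, 2, 0, 1, 2, 1, 2, 0, 1, 2, 1, 2] (by decide +kernel)
  · rw [← mul_inv_eq_one]
    simpa [wordPerm, mul_assoc, hinv] using hword [0, 2, 1, 0, 1, 0, 1, 2] (by decide +kernel)

end APolytope

/-- There is no rank-4 abstract polytope whose facets and vertex figures are,
respectively, all isomorphic to: the tetrahedron `{3,3}` and the hemioctahedron
`{3,4}₃`; the tetrahedron `{3,3}` and the hemi-icosahedron `{3,5}₅`; the octahedron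
`{3,4}` and the hemicube `{4,3}₃`; the hemioctahedron `{3,4}₃` and the hemicube
`{4,3}₃`; or the hemioctahedron `{3,4}₃` and the cube `{4,3}`. (That is, there are no
locally projective polytopes of types `{3,3,4}`, `{3,3,5}` or `{3,4,3}`.) -/
theorem statement_8 :
    (¬ ∃ P : APolytope.{u} 4,
      P.FacetsAre TetraPoset ∧ P.VertexFiguresAre HemiOctaPoset) ∧
    (¬ ∃ P : APolytope.{u} 4,
      P.FacetsAre TetraPoset ∧ P.VertexFiguresAre HemiIcosaPoset) ∧
    (¬ ∃ P : APolytope.{u} 4,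
      P.FacetsAre OctaPoset ∧ P.VertexFiguresAre HemicubePoset) ∧
    (¬ ∃ P : APolytope.{u} 4,
      P.FacetsAre HemiOctaPoset ∧ P.VertexFiguresAre HemicubePoset) ∧
    (¬ ∃ P : APolytope.{u} 4,
      P.FacetsAre HemiOctaPoset ∧ P.VertexFiguresAre CubePoset) := by
  refine ⟨?_, ?_, ?_, ?_, ?_⟩ <;> rintro ⟨P, hF, hV⟩
  · exact APolytope.not_hemioctahedral_vertexFigures
      (hF.wordPerm_eq_one (codes_tetra.closedWord (w := [0, 2, 0, 2]) (by decide +kernel)))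
      (hF.wordPerm_eq_one (codes_tetra.closedWord (w := [0, 1, 0, 1, 0, 1]) (by decide +kernel))) hV
  · exact APolytope.not_hemiIcosahedral_vertexFigures
      (hF.wordPerm_eq_one (codes_tetra.closedWord (w := [0, 2, 0, 2]) (by decide +kernel)))
      (hF.wordPerm_eq_one (codes_tetra.closedWord (w := [0, 1, 0, 1, 0, 1]) (by decide +kernel))) hV
  · exact APolytope.not_hemicubical_vertexFigures
      (hF.wordPerm_eq_one (codes_cube.closedWord_dual (w := [0, 2, 0, 2]) (by decide +kernel)))
      (hF.wordPerm_eq_one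
        (codes_cube.closedWord_dual (w := [0, 1, 0, 1, 0, 1]) (by decide +kernel))) hV
  · exact APolytope.not_hemicubical_vertexFigures
      (hF.wordPerm_eq_one (codes_hemicube.closedWord_dual (w := [0, 2, 0, 2]) (by decide +kernel)))
      (hF.wordPerm_eq_one
        (codes_hemicube.closedWord_dual (w := [0, 1, 0, 1, 0, 1]) (by decide +kernel))) hV
  · exact APolytope.not_hemioctahedral_facets
      (hV.wordPerm_eq_one (codes_cube.closedWord (w := [2, 0, 2, 0]) (by decide +kernel)))
      (hV.wordPerm_eq_one
        (codes_cube.closedWord (w := [2, 1, 2, 1, 2, 1]) (by decide +kernel))) hF
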